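/- arXiv:0903.0641 — 2 statements merged into one kernel-verified Lean document; each statement's English description precedes it below -/
import Mathlib

section
/- Every maximal two-sided ideal of S_n contains the ideal a_n; consequently M ↦ M/a_n is a bijection from the set of maximal two-sided ideals of S_n onto the set of maximal ideals of the quotient ring S_n/a_n, and S_n/a_n is isomorphic as a K-algebra to the Laurent polynomial algebra L_n = K[x_1, x_1^{−1}, …, x_n, x_n^{−1}]. -/
set_option synthInstance.maxHeartbeats 1000000
set_option maxHeartbeats 1000000

open MvPolynomial

noncomputable section

/-- The polynomial algebra `P_n = K[x_1, …, x_n]`. -/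
abbrev PolyAlg (K : Type u) [Field K] (n : ℕ) := MvPolynomial (Fin n) K

/-- `X_i` : multiplication by the variable `x_i`, as a `K`-linear endomorphism of `P_n`. -/
def Xop (K : Type u) [Field K] (n : ℕ) (i : Fin n) : Module.End K (PolyAlg K n) :=
  LinearMap.mulLeft K (X i)

/-- `Y_i` : the left inverse of `X_i`, sending a monomial `x^α` to `x^{α - e_i}` if `α i ≥ 1`
and to `0` otherwise. -/
def Yop (K : Type u) [Field K] (n : ℕ) (i : Fin n) : Module.End K (PolyAlg K n) :=
  (basisMonomials (Fin n) K).constr K fun α =>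
    if α i = 0 then 0 else monomial (α - Finsupp.single i 1) (1 : K)

/-- The algebra `S_n` of one-sided inverses of `P_n` : the subalgebra of `End_K(P_n)`
generated by `X_1, …, X_n, Y_1, …, Y_n`. -/
def SnAlg (K : Type u) [Field K] (n : ℕ) : Subalgebra K (Module.End K (PolyAlg K n)) :=
  Algebra.adjoin K (Set.range (Xop K n) ∪ Set.range (Yop K n))

/-- `x_i` as an element of `S_n`. -/
def xS (K : Type u) [Field K] (n : ℕ) (i : Fin n) : SnAlg K n :=
  ⟨Xop K n i, Algebra.subset_adjoin (Set.mem_union_left _ ⟨i, rfl⟩)⟩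

/-- `y_i` as an element of `S_n`. -/
def yS (K : Type u) [Field K] (n : ℕ) (i : Fin n) : SnAlg K n :=
  ⟨Yop K n i, Algebra.subset_adjoin (Set.mem_union_right _ ⟨i, rfl⟩)⟩

/-- The product `I*J` of two two-sided ideals: the two-sided ideal generated by all products
`a * b` with `a ∈ I`, `b ∈ J`. -/
def tsiMul {R : Type*} [Ring R] (I J : TwoSidedIdeal R) : TwoSidedIdeal R :=
  TwoSidedIdeal.span {x | ∃ a ∈ I, ∃ b ∈ J, x = a * b}

/-- A two-sided ideal `P` of a ring is prime if it is proper and for all two-sided ideals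
`I`, `J`, `I*J ⊆ P` implies `I ⊆ P` or `J ⊆ P`. -/
def tsiPrime {R : Type*} [Ring R] (P : TwoSidedIdeal R) : Prop :=
  P ≠ ⊤ ∧ ∀ I J : TwoSidedIdeal R, tsiMul I J ≤ P → I ≤ P ∨ J ≤ P

/-- The ideal `p_i` of `S_n`, generated by `1 - x_i y_i`. -/
def pIdeal (K : Type u) [Field K] (n : ℕ) (i : Fin n) : TwoSidedIdeal (SnAlg K n) :=
  TwoSidedIdeal.span {1 - xS K n i * yS K n i}

/-- The ideal `a_n = p_1 + ⋯ + p_n` of `S_n`. -/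
def aIdeal (K : Type u) [Field K] (n : ℕ) : TwoSidedIdeal (SnAlg K n) := ⨆ i, pIdeal K n i

/-- The quotient ring `S_n / a_n`. -/
abbrev SnModAn (K : Type u) [Field K] (n : ℕ) := (aIdeal K n).ringCon.Quotient

/-- The Laurent polynomial algebra `L_n = K[x_1^{±1}, …, x_n^{±1}]`, realized as the group
algebra of `ℤ^n` over `K`. -/
abbrev LaurentAlg (K : Type u) [Field K] (n : ℕ) := AddMonoidAlgebra K (Fin n →₀ ℤ)

section Operators

variable (K : Type*) [Field K] (n : ℕ)

lemma Yop_monomial (i : Fin n) (α : Fin n →₀ ℕ) :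
    Yop K n i (monomial α 1) =
      if α i = 0 then 0 else monomial (α - Finsupp.single i 1) (1 : K) := by
  have h := (basisMonomials (Fin n) K).constr_basis K (fun α : Fin n →₀ ℕ =>
    if α i = 0 then 0 else monomial (α - Finsupp.single i 1) (1 : K)) α
  rwa [coe_basisMonomials] at h

lemma Xop_monomial (i : Fin n) (α : Fin n →₀ ℕ) :
    Xop K n i (monomial α 1) = monomial (α + Finsupp.single i 1) (1 : K) := by
  simp [Xop, X, monomial_mul, add_comm]

lemma Yop_mul_Xop (i : Fin n) : Yop K n i * Xop K n i = 1 := by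
  refine (basisMonomials (Fin n) K).ext fun α => ?_
  simp [Module.End.mul_apply, Xop_monomial, Yop_monomial]

lemma Yop_X_mul (i : Fin n) (p : PolyAlg K n) : Yop K n i (X i * p) = p :=
  LinearMap.congr_fun (Yop_mul_Xop K n i) p

lemma commute_Xop_Xop (i j : Fin n) : Commute (Xop K n i) (Xop K n j) := by
  refine LinearMap.ext fun p => ?_
  simp [Module.End.mul_apply, Xop, mul_left_comm]

lemma commute_Yop_Xop {i j : Fin n} (h : i ≠ j) : Commute (Yop K n i) (Xop K n j) := by
  refine (basisMonomials (Fin n) K).ext fun α => ?_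
  simp only [coe_basisMonomials, Module.End.mul_apply, Xop_monomial, Yop_monomial]
  have hj : (α + Finsupp.single j 1 : Fin n →₀ ℕ) i = α i := by simp [h]
  rw [hj]
  split_ifs with h0
  · simp
  · rw [Xop_monomial]
    congr 2
    ext k
    simp only [Finsupp.add_apply, Finsupp.tsub_apply, Finsupp.single_apply]
    split_ifs <;> grind

lemma commute_Yop_Yop (i j : Fin n) : Commute (Yop K n i) (Yop K n j) := by
  rcases eq_or_ne i j with rfl | h
  · exact Commute.refl _
  refine (basisMonomials (Fin n) K).ext fun α => ?_
  simp only [coe_basisMonomials, Module.End.mul_apply, Yop_monomial]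
  have hj : (α - Finsupp.single j 1 : Fin n →₀ ℕ) i = α i := by simp [h]
  have hi : (α - Finsupp.single i 1 : Fin n →₀ ℕ) j = α j := by simp [h.symm]
  by_cases h1 : α i = 0 <;> by_cases h2 : α j = 0 <;>
    simp [h1, h2, Yop_monomial, hi, hj, tsub_right_comm, -Finsupp.coe_tsub]

lemma yS_mul_xS (i : Fin n) : yS K n i * xS K n i = 1 := Subtype.ext (Yop_mul_Xop K n i)

lemma commute_xS_xS (i j : Fin n) : Commute (xS K n i) (xS K n j) :=
  Subtype.ext (commute_Xop_Xop K n i j)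

lemma commute_yS_yS (i j : Fin n) : Commute (yS K n i) (yS K n j) :=
  Subtype.ext (commute_Yop_Yop K n i j)

lemma commute_yS_xS {i j : Fin n} (h : i ≠ j) : Commute (yS K n i) (xS K n j) :=
  Subtype.ext (commute_Yop_Xop K n h)

end Operators

variable {K : Type*} [Field K] {n : ℕ}

lemma SnAlg.induction {P : SnAlg K n → Prop} (hx : ∀ i, P (xS K n i)) (hy : ∀ i, P (yS K n i))
    (hc : ∀ c, P (algebraMap K (SnAlg K n) c)) (hadd : ∀ s t, P s → P t → P (s + t))
    (hmul : ∀ s t, P s → P t → P (s * t)) (s : SnAlg K n) : P s := by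
  obtain ⟨s, hs⟩ := s
  refine Algebra.adjoin_induction (p := fun s hs => P ⟨s, hs⟩) ?_ hc
    (fun s t hs ht => hadd ⟨s, hs⟩ ⟨t, ht⟩) (fun s t hs ht => hmul ⟨s, hs⟩ ⟨t, ht⟩) hs
  rintro _ (⟨i, rfl⟩ | ⟨i, rfl⟩)
  exacts [hx i, hy i]

section Maximal

lemma yS_pow_mul_xS_pow (i : Fin n) (N : ℕ) : yS K n i ^ N * xS K n i ^ N = 1 := by
  induction N with
  | zero => simp
  | succ N ih => rw [pow_succ, pow_succ', mul_assoc, ← mul_assoc (yS K n i), yS_mul_xS, one_mul, ih]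

lemma yS_pow_mul_eq_zero_of_le {i : Fin n} {M N : ℕ} (h : M ≤ N) {p : SnAlg K n}
    (hp : yS K n i ^ M * p = 0) : yS K n i ^ N * p = 0 := by
  rw [← Nat.sub_add_cancel h, pow_add, mul_assoc, hp, mul_zero]

lemma exists_yS_pow_mul_mul_eq_zero (i : Fin n) (s : SnAlg K n) : ∀ p : SnAlg K n,
    (∃ N, yS K n i ^ N * p = 0) → ∃ N, yS K n i ^ N * (s * p) = 0 := by
  have key (s : SnAlg K n) (h : Commute (yS K n i) s) (p : SnAlg K n) :
      (∃ N, yS K n i ^ N * p = 0) → ∃ N, yS K n i ^ N * (s * p) = 0 := by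
    rintro ⟨N, hN⟩
    exact ⟨N, by rw [← mul_assoc, (h.pow_left N).eq, mul_assoc, hN, mul_zero]⟩
  induction s using SnAlg.induction with
  | hx j =>
    rcases eq_or_ne i j with rfl | h
    · rintro p ⟨N, hN⟩
      exact ⟨N + 1, by rw [pow_succ, mul_assoc, ← mul_assoc (yS K n i), yS_mul_xS, one_mul, hN]⟩
    · exact key _ (commute_yS_xS K n h)
  | hy j => exact key _ (commute_yS_yS K n i j)
  | hc c => exact key _ (Algebra.commutes c _).symm
  | hadd s t hs ht =>
    intro p hp
    obtain ⟨N, hN⟩ := hs p hp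
    obtain ⟨M, hM⟩ := ht p hp
    refine ⟨max N M, ?_⟩
    rw [add_mul, mul_add, yS_pow_mul_eq_zero_of_le (le_max_left _ _) hN,
      yS_pow_mul_eq_zero_of_le (le_max_right _ _) hM, add_zero]
  | hmul s t hs ht =>
    intro p hp
    rw [mul_assoc]
    exact hs _ (ht p hp)

lemma exists_yS_pow_mul_eq_zero {i : Fin n} {p : SnAlg K n} (hp : p ∈ pIdeal K n i) :
    ∃ N, yS K n i ^ N * p = 0 := by
  refine (TwoSidedIdeal.mem_mk' {p | ∃ N, yS K n i ^ N * p = 0} ⟨0, mul_zero _⟩ ?_ ?_ ?_ ?_ p).1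
    (TwoSidedIdeal.mem_span_iff.1 hp _ ?_)
  · rintro p q ⟨N, hN⟩ ⟨M, hM⟩
    refine ⟨max N M, ?_⟩
    rw [mul_add, yS_pow_mul_eq_zero_of_le (le_max_left _ _) hN,
      yS_pow_mul_eq_zero_of_le (le_max_right _ _) hM, add_zero]
  · rintro p ⟨N, hN⟩
    refine ⟨N, (add_zero _).symm.trans ?_⟩
    nth_rewrite 1 [← hN]
    rw [← mul_add]
    exact (congrArg _ (neg_add_cancel p)).trans (mul_zero _)
  · exact fun {s p} hp => exists_yS_pow_mul_mul_eq_zero i s p hp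
  · rintro p s ⟨N, hN⟩
    exact ⟨N, by rw [← mul_assoc, hN, zero_mul]⟩
  · rw [Set.singleton_subset_iff, SetLike.mem_coe, TwoSidedIdeal.mem_mk']
    refine ⟨1, ?_⟩
    rw [pow_one]
    refine Subtype.ext ((mul_sub _ _ _).trans (sub_eq_zero.2 ?_))
    change Yop K n i * 1 = Yop K n i * (Xop K n i * Yop K n i)
    rw [← mul_assoc, Yop_mul_Xop, mul_one, one_mul]

lemma pIdeal_le_of_isCoatom {M : TwoSidedIdeal (SnAlg K n)} (hM : IsCoatom M) (i : Fin n) :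
    pIdeal K n i ≤ M := by
  by_contra h
  have htop : M ⊔ pIdeal K n i = ⊤ := hM.2 _ (left_lt_sup.2 h)
  have h1 : (1 : SnAlg K n) ∈ M ⊔ pIdeal K n i := htop ▸ TwoSidedIdeal.mem_top _
  obtain ⟨m, hm, p, hp, hmp⟩ := TwoSidedIdeal.mem_sup.1 h1
  obtain ⟨N, hN⟩ := exists_yS_pow_mul_eq_zero hp
  refine hM.1 ((TwoSidedIdeal.one_mem_iff M).1 ?_)
  have h2 : yS K n i ^ N * m * xS K n i ^ N = 1 := by
    rw [← add_zero (yS K n i ^ N * m), ← hN, ← mul_add, hmp, mul_one, yS_pow_mul_xS_pow]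
  exact h2 ▸ M.mul_mem_right _ _ (M.mul_mem_left _ _ hm)

lemma aIdeal_le_of_isCoatom {M : TwoSidedIdeal (SnAlg K n)} (hM : IsCoatom M) :
    aIdeal K n ≤ M :=
  iSup_le (pIdeal_le_of_isCoatom hM)

end Maximal

section Correspondence

variable {R S : Type*} [Ring R] [Ring S] {f : R →+* S}

lemma TwoSidedIdeal.mem_span_image_of_surjective (hf : Function.Surjective f)
    (M : TwoSidedIdeal R) (y : S) :
    y ∈ TwoSidedIdeal.span (f '' (M : Set R)) ↔ ∃ x ∈ M, f x = y := by
  refine ⟨fun h => ?_, fun h => TwoSidedIdeal.subset_span h⟩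
  refine (TwoSidedIdeal.mem_mk' (f '' (M : Set R)) ⟨0, M.zero_mem, map_zero f⟩ ?_ ?_ ?_ ?_ y).1
    (TwoSidedIdeal.mem_span_iff.1 h _ ?_)
  · rintro _ _ ⟨a, ha, rfl⟩ ⟨b, hb, rfl⟩
    exact ⟨a + b, M.add_mem ha hb, map_add f a b⟩
  · rintro _ ⟨a, ha, rfl⟩
    exact ⟨-a, M.neg_mem ha, map_neg f a⟩
  · rintro s _ ⟨a, ha, rfl⟩
    obtain ⟨r, rfl⟩ := hf s
    exact ⟨r * a, M.mul_mem_left _ _ ha, map_mul f r a⟩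
  · rintro _ s ⟨a, ha, rfl⟩
    obtain ⟨r, rfl⟩ := hf s
    exact ⟨a * r, M.mul_mem_right _ _ ha, map_mul f a r⟩
  · intro y hy
    exact (TwoSidedIdeal.mem_mk' _ _ _ _ _ _ _).2 hy

/-- The correspondence between the two-sided ideals containing the kernel of a surjective ring
homomorphism and the two-sided ideals of its target. -/
def TwoSidedIdeal.correspondence (hf : Function.Surjective f) :
    Set.Ici (TwoSidedIdeal.ker f) ≃o TwoSidedIdeal S where
  toFun M := TwoSidedIdeal.span (f '' (M.1 : Set R))
  invFun N := ⟨N.comap f, fun x hx => (TwoSidedIdeal.mem_comap f).2 <| by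
    rw [(TwoSidedIdeal.mem_ker f).1 hx]; exact N.zero_mem⟩
  left_inv M := Subtype.ext <| TwoSidedIdeal.ext fun x => by
    rw [TwoSidedIdeal.mem_comap, TwoSidedIdeal.mem_span_image_of_surjective hf]
    refine ⟨?_, fun h => ⟨x, h, rfl⟩⟩
    rintro ⟨y, hy, hxy⟩
    have h : x - y ∈ TwoSidedIdeal.ker f := by
      rw [TwoSidedIdeal.mem_ker, map_sub, hxy, sub_self]
    simpa using M.1.add_mem (M.2 h) hy
  right_inv N := TwoSidedIdeal.ext fun y => by
    rw [TwoSidedIdeal.mem_span_image_of_surjective hf]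
    refine ⟨?_, fun h => ?_⟩
    · rintro ⟨x, hx, rfl⟩
      exact (TwoSidedIdeal.mem_comap f).1 hx
    · obtain ⟨x, rfl⟩ := hf y
      exact ⟨x, (TwoSidedIdeal.mem_comap f).2 h, rfl⟩
  map_rel_iff' := by
    intro M N
    refine ⟨fun h x hx => ?_, fun h => TwoSidedIdeal.span_mono (Set.image_mono h)⟩
    obtain ⟨y, hy, hxy⟩ := (TwoSidedIdeal.mem_span_image_of_surjective hf _ _).1
      (h ((TwoSidedIdeal.mem_span_image_of_surjective hf _ _).2 ⟨x, hx, rfl⟩))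
    have h : x - y ∈ TwoSidedIdeal.ker f := by
      rw [TwoSidedIdeal.mem_ker, map_sub, hxy, sub_self]
    simpa using N.1.add_mem (N.2 h) hy

lemma TwoSidedIdeal.bijOn_span_image_isCoatom (hf : Function.Surjective f)
    (h : ∀ M : TwoSidedIdeal R, IsCoatom M → TwoSidedIdeal.ker f ≤ M) :
    Set.BijOn (fun M : TwoSidedIdeal R => TwoSidedIdeal.span (f '' (M : Set R)))
      {M | IsCoatom M} {M | IsCoatom M} := by
  let e := TwoSidedIdeal.correspondence hf
  refine ⟨fun M hM => ?_, fun M hM N hN hMN => ?_, fun N hN => ?_⟩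
  · exact (e.isCoatom_iff ⟨M, h M hM⟩).2 (hM.Ici (h M hM))
  · exact congrArg Subtype.val
      (e.injective (a₁ := ⟨M, h M hM⟩) (a₂ := ⟨N, h N hN⟩) hMN)
  · refine ⟨(e.symm N).1, IsCoatom.of_isCoatom_coe_Ici ((e.symm.isCoatom_iff N).2 hN), ?_⟩
    exact e.apply_symm_apply N

end Correspondence

section Symbol

/-- The inclusion of the polynomial algebra into the Laurent polynomial algebra. -/
def polyToLaurent (K : Type*) [Field K] (n : ℕ) : PolyAlg K n →ₐ[K] LaurentAlg K n :=
  aeval fun i => AddMonoidAlgebra.single (Finsupp.single i 1) 1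

/-- The product of all the variables. -/
def prodVars (K : Type*) [Field K] (n : ℕ) : PolyAlg K n := ∏ i, X i

lemma single_mul_single_neg (i : Fin n) :
    (AddMonoidAlgebra.single (Finsupp.single i 1) 1 : LaurentAlg K n) *
      AddMonoidAlgebra.single (Finsupp.single i (-1)) 1 = 1 := by
  rw [AddMonoidAlgebra.single_mul_single, ← Finsupp.single_add]
  simp [AddMonoidAlgebra.one_def]

lemma isUnit_polyToLaurent_prodVars : IsUnit (polyToLaurent K n (prodVars K n)) := by
  rw [prodVars, map_prod]
  refine IsUnit.prod_univ_iff.2 fun i => ?_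
  rw [polyToLaurent, aeval_X]
  exact IsUnit.of_mul_eq_one _ (single_mul_single_neg i)

/-- `s` acts on polynomials divisible by a high power of the product of the variables as
multiplication by the Laurent polynomial `l`, and preserves high divisibility. -/
def IsSymbol (s : SnAlg K n) (l : LaurentAlg K n) : Prop :=
  ∀ N, ∃ M, ∀ p, ∃ q, s.1 (prodVars K n ^ M * p) = prodVars K n ^ N * q ∧
    polyToLaurent K n (prodVars K n ^ N * q) = l * polyToLaurent K n (prodVars K n ^ M * p)

lemma IsSymbol.unique {s : SnAlg K n} {l m : LaurentAlg K n} (hl : IsSymbol s l)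
    (hm : IsSymbol s m) : l = m := by
  obtain ⟨M, hM⟩ := hl 0
  obtain ⟨M', hM'⟩ := hm 0
  obtain ⟨q, hq, hql⟩ := hM (prodVars K n ^ M')
  obtain ⟨q', hq', hql'⟩ := hM' (prodVars K n ^ M)
  rw [mul_comm (prodVars K n ^ M')] at hq' hql'
  rw [← hq] at hql
  rw [← hq', hql, map_mul, map_pow, map_pow] at hql'
  exact ((isUnit_polyToLaurent_prodVars.pow M).mul
    (isUnit_polyToLaurent_prodVars.pow M')).mul_right_cancel hql'

lemma IsSymbol.add {s t : SnAlg K n} {l m : LaurentAlg K n} (hl : IsSymbol s l)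
    (hm : IsSymbol t m) : IsSymbol (s + t) (l + m) := by
  intro N
  obtain ⟨M, hM⟩ := hl N
  obtain ⟨M', hM'⟩ := hm N
  refine ⟨M + M', fun p => ?_⟩
  obtain ⟨q, hq, hql⟩ := hM (prodVars K n ^ M' * p)
  obtain ⟨q', hq', hql'⟩ := hM' (prodVars K n ^ M * p)
  rw [mul_left_comm, ← mul_assoc, ← pow_add] at hq' hql'
  rw [← mul_assoc, ← pow_add] at hq hql
  refine ⟨q + q', ?_, ?_⟩
  · rw [mul_add, ← hq, ← hq']
    rfl
  · rw [mul_add, map_add, hql, hql', add_mul]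

lemma IsSymbol.mul {s t : SnAlg K n} {l m : LaurentAlg K n} (hl : IsSymbol s l)
    (hm : IsSymbol t m) : IsSymbol (s * t) (l * m) := by
  intro N
  obtain ⟨M, hM⟩ := hl N
  obtain ⟨M', hM'⟩ := hm M
  refine ⟨M', fun p => ?_⟩
  obtain ⟨q, hq, hql⟩ := hM' p
  obtain ⟨r, hr, hrl⟩ := hM q
  refine ⟨r, ?_, ?_⟩
  · rw [← hr, ← hq]
    rfl
  · rw [hrl, hql, mul_assoc]

lemma isSymbol_algebraMap (c : K) :
    IsSymbol (algebraMap K (SnAlg K n) c) (algebraMap K (LaurentAlg K n) c) := by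
  refine fun N => ⟨N, fun p => ⟨c • p, ?_, ?_⟩⟩
  · rw [mul_smul_comm]
    rfl
  · rw [mul_smul_comm, map_smul, Algebra.smul_def]

lemma isSymbol_xS (i : Fin n) :
    IsSymbol (xS K n i) (AddMonoidAlgebra.single (Finsupp.single i 1) 1) := by
  refine fun N => ⟨N, fun p => ⟨X i * p, mul_left_comm _ _ _, ?_⟩⟩
  rw [mul_left_comm, map_mul, polyToLaurent, aeval_X]

lemma isSymbol_yS (i : Fin n) :
    IsSymbol (yS K n i) (AddMonoidAlgebra.single (Finsupp.single i (-1)) 1) := by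
  intro N
  obtain ⟨w, hw⟩ : X i ∣ prodVars K n := Finset.dvd_prod_of_mem _ (Finset.mem_univ i)
  have h (p : PolyAlg K n) :
      prodVars K n ^ (N + 1) * p = X i * (prodVars K n ^ N * (w * p)) := by
    rw [pow_succ, mul_assoc]
    nth_rewrite 2 [hw]
    ring
  refine ⟨N + 1, fun p => ⟨w * p, ?_, ?_⟩⟩
  · rw [h]
    exact Yop_X_mul K n i _
  · rw [h, map_mul _ (X i), ← mul_assoc (AddMonoidAlgebra.single _ _)]
    have hX : polyToLaurent K n (X i) = AddMonoidAlgebra.single (Finsupp.single i 1) 1 :=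
      aeval_X _ i
    rw [hX, mul_comm (AddMonoidAlgebra.single _ (1 : K)), single_mul_single_neg, one_mul]

lemma exists_isSymbol (s : SnAlg K n) : ∃ l, IsSymbol s l := by
  induction s using SnAlg.induction with
  | hx i => exact ⟨_, isSymbol_xS i⟩
  | hy i => exact ⟨_, isSymbol_yS i⟩
  | hc c => exact ⟨_, isSymbol_algebraMap c⟩
  | hadd s t hs ht => exact ⟨_, hs.choose_spec.add ht.choose_spec⟩
  | hmul s t hs ht => exact ⟨_, hs.choose_spec.mul ht.choose_spec⟩

/-- The homomorphism from `S_n` to the Laurent polynomial algebra, sending `x_i` to `x_i` and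
`y_i` to `x_i⁻¹`. -/
def symbol (K : Type*) [Field K] (n : ℕ) : SnAlg K n →ₐ[K] LaurentAlg K n :=
  AlgHom.ofLinearMap
    { toFun s := (exists_isSymbol s).choose
      map_add' s t := (exists_isSymbol (s + t)).choose_spec.unique
        ((exists_isSymbol s).choose_spec.add (exists_isSymbol t).choose_spec)
      map_smul' c s := (exists_isSymbol (c • s)).choose_spec.unique <| by
        rw [RingHom.id_apply, Algebra.smul_def, Algebra.smul_def]
        exact (isSymbol_algebraMap c).mul (exists_isSymbol s).choose_spec }
    ((exists_isSymbol 1).choose_spec.unique <| by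
      simpa only [map_one] using isSymbol_algebraMap (n := n) (1 : K))
    fun s t => (exists_isSymbol (s * t)).choose_spec.unique
      ((exists_isSymbol s).choose_spec.mul (exists_isSymbol t).choose_spec)

lemma symbol_eq {s : SnAlg K n} {l : LaurentAlg K n} (h : IsSymbol s l) : symbol K n s = l :=
  (exists_isSymbol s).choose_spec.unique h

lemma aIdeal_le_ker_symbol :
    aIdeal K n ≤
      TwoSidedIdeal.ofRingCon (RingCon.ker (symbol K n : SnAlg K n →+* LaurentAlg K n)) := by
  refine iSup_le fun i => TwoSidedIdeal.span_le.2 ?_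
  rw [Set.singleton_subset_iff, SetLike.mem_coe, TwoSidedIdeal.mem_ofRingCon]
  change symbol K n _ = symbol K n 0
  have h1 : symbol K n (xS K n i * yS K n i) = 1 := by
    rw [map_mul, symbol_eq (isSymbol_xS i), symbol_eq (isSymbol_yS i), single_mul_single_neg]
  have h2 : symbol K n (1 - xS K n i * yS K n i) + symbol K n (xS K n i * yS K n i) =
      symbol K n 1 :=
    (map_add _ _ _).symm.trans (congrArg _ (Subtype.ext (sub_add_cancel _ _)))
  rw [h1, map_one, add_eq_right] at h2
  rw [h2, map_zero]

end Symbol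

section Quotient

lemma exists_laurent_ringHom {A : Type*} [CommRing A] (f : K →+* A) (u : Fin n → Aˣ) :
    ∃ τ : LaurentAlg K n →+* A, (∀ c, τ (algebraMap K (LaurentAlg K n) c) = f c) ∧
      ∀ i (a : ℤ), τ (AddMonoidAlgebra.single (Finsupp.single i a) 1) = ↑(u i ^ a) := by
  let := f.toAlgebra
  let g : Multiplicative (Fin n →₀ ℤ) →* Aˣ :=
    { toFun α := ∏ i, u i ^ (α.toAdd i)
      map_one' := by simp
      map_mul' α β := by simp [zpow_add, Finset.prod_mul_distrib] }
  let τ := AddMonoidAlgebra.lift K A (Fin n →₀ ℤ) ((Units.coeHom A).comp g)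
  refine ⟨τ, fun c => τ.commutes c, fun i a => ?_⟩
  have h : g (Multiplicative.ofAdd (Finsupp.single i a)) = u i ^ a := by
    change ∏ j, u j ^ (Finsupp.single i a j) = _
    rw [Finset.prod_eq_single i] <;> simp +contextual [eq_comm]
  change τ _ = _
  simp [τ, AddMonoidAlgebra.lift_single, h]

/-- The quotient map `S_n → S_n / a_n`. -/
abbrev quotMap (K : Type*) [Field K] (n : ℕ) : SnAlg K n →+* SnModAn K n :=
  RingCon.mk' (aIdeal K n).ringCon

lemma quotMap_xS_mul_yS (i : Fin n) :
    quotMap K n (xS K n i) * quotMap K n (yS K n i) = 1 := by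
  rw [← map_mul, ← map_one (quotMap K n), eq_comm]
  refine (RingCon.eq _).2 ((TwoSidedIdeal.rel_iff _ _ _).2 ?_)
  exact le_iSup (pIdeal K n) i (TwoSidedIdeal.subset_span rfl)

lemma quotMap_yS_mul_xS (i : Fin n) :
    quotMap K n (yS K n i) * quotMap K n (xS K n i) = 1 := by
  rw [← map_mul, yS_mul_xS, map_one]

lemma commute_quotMap_yS_xS (i j : Fin n) :
    Commute (quotMap K n (yS K n i)) (quotMap K n (xS K n j)) := by
  rcases eq_or_ne i j with rfl | h
  · exact (quotMap_yS_mul_xS i).trans (quotMap_xS_mul_yS i).symm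
  · exact (commute_yS_xS K n h).map _

lemma commute_quotMap_of_forall {a : SnModAn K n} (hx : ∀ i, Commute (quotMap K n (xS K n i)) a)
    (hy : ∀ i, Commute (quotMap K n (yS K n i)) a)
    (hc : ∀ c, Commute (quotMap K n (algebraMap K _ c)) a) (s : SnAlg K n) :
    Commute (quotMap K n s) a := by
  induction s using SnAlg.induction with
  | hx i => exact hx i
  | hy i => exact hy i
  | hc c => exact hc c
  | hadd s t hs ht => rw [map_add]; exact hs.add_left ht
  | hmul s t hs ht => rw [map_mul]; exact hs.mul_left ht

lemma commute_quotMap (s t : SnAlg K n) : Commute (quotMap K n s) (quotMap K n t) := by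
  have hc (c : K) (r : SnAlg K n) :
      Commute (quotMap K n (algebraMap K _ c)) (quotMap K n r) :=
    Commute.map (Algebra.commutes c r) _
  refine commute_quotMap_of_forall (fun i => ?_) (fun i => ?_) (fun c => hc c t) s
  · exact (commute_quotMap_of_forall (fun j => (commute_xS_xS K n j i).map _)
      (fun j => commute_quotMap_yS_xS j i) (fun c => hc c _) t).symm
  · exact (commute_quotMap_of_forall (fun j => (commute_quotMap_yS_xS i j).symm)
      (fun j => (commute_yS_yS K n j i).map _) (fun c => hc c _) t).symm

lemma exists_laurent_ringHom_quot : ∃ τ : LaurentAlg K n →+* SnModAn K n,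
    ∀ s, τ (symbol K n s) = quotMap K n s := by
  let : CommRing (SnModAn K n) :=
    { (inferInstance : Ring (SnModAn K n)) with
      mul_comm a b := by
        obtain ⟨s, rfl⟩ := RingCon.mk'_surjective _ a
        obtain ⟨t, rfl⟩ := RingCon.mk'_surjective _ b
        exact commute_quotMap s t }
  let u (i : Fin n) : (SnModAn K n)ˣ :=
    ⟨quotMap K n (xS K n i), quotMap K n (yS K n i), quotMap_xS_mul_yS i, quotMap_yS_mul_xS i⟩
  obtain ⟨τ, hc, hu⟩ :=
    exists_laurent_ringHom ((quotMap K n).comp (algebraMap K (SnAlg K n))) u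
  refine ⟨τ, fun s => ?_⟩
  induction s using SnAlg.induction with
  | hx i => rw [symbol_eq (isSymbol_xS i), hu, zpow_one]
  | hy i => rw [symbol_eq (isSymbol_yS i), hu, zpow_neg_one]; rfl
  | hc c => rw [AlgHom.commutes, hc]; rfl
  | hadd s t hs ht => rw [map_add, map_add, map_add, hs, ht]
  | hmul s t hs ht => rw [map_mul, map_mul, map_mul, hs, ht]

lemma symbol_surjective : Function.Surjective (symbol K n) := by
  have hx (i : Fin n) (a : ℤ) :
      AddMonoidAlgebra.single (Finsupp.single i a) 1 ∈ (symbol K n).range := by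
    have hx1 := AlgHom.mem_range_self (symbol K n) (xS K n i)
    have hy1 := AlgHom.mem_range_self (symbol K n) (yS K n i)
    rw [symbol_eq (isSymbol_xS i)] at hx1
    rw [symbol_eq (isSymbol_yS i)] at hy1
    obtain ⟨k, rfl | rfl⟩ := a.eq_nat_or_neg
    · simpa [AddMonoidAlgebra.single_pow] using pow_mem hx1 k
    · simpa [AddMonoidAlgebra.single_pow] using pow_mem hy1 k
  have hα (α : Fin n →₀ ℤ) : AddMonoidAlgebra.single α 1 ∈ (symbol K n).range := by
    induction α using Finsupp.induction_linear with
    | zero => exact one_mem _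
    | add α β hα hβ =>
      simpa [AddMonoidAlgebra.single_mul_single] using mul_mem hα hβ
    | single i a => exact hx i a
  intro l
  change l ∈ (symbol K n).range
  induction l using AddMonoidAlgebra.induction_on with
  | of α => exact hα α
  | add f g hf hg => exact add_mem hf hg
  | smul c f hf => exact Subalgebra.smul_mem _ hf c

end Quotient

/-- every maximal two-sided ideal of `S_n` contains `a_n`; `M ↦ M/a_n` is a
bijection from the maximal two-sided ideals of `S_n` onto the maximal two-sided ideals of
`S_n/a_n`; and `S_n/a_n` is isomorphic, as a `K`-algebra, to the Laurent polynomial algebra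
`L_n`. -/
theorem statement11 (K : Type u) [Field K] (n : ℕ) (hn : 0 < n) :
    (∀ M : TwoSidedIdeal (SnAlg K n), IsCoatom M → aIdeal K n ≤ M) ∧
    Set.BijOn
      (fun M : TwoSidedIdeal (SnAlg K n) =>
        TwoSidedIdeal.span (⇑(RingCon.mk' (aIdeal K n).ringCon) '' (M : Set (SnAlg K n))))
      {M : TwoSidedIdeal (SnAlg K n) | IsCoatom M}
      {M' : TwoSidedIdeal (SnModAn K n) | IsCoatom M'} ∧
    ∃ e : SnModAn K n ≃+* LaurentAlg K n,
      ∀ c : K, e (RingCon.mk' (aIdeal K n).ringCon (algebraMap K (SnAlg K n) c)) =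
        algebraMap K (LaurentAlg K n) c := by
  have hle : (aIdeal K n).ringCon ≤ RingCon.ker (symbol K n : SnAlg K n →+* LaurentAlg K n) :=
    TwoSidedIdeal.ringCon_le_iff.1 aIdeal_le_ker_symbol
  refine ⟨fun M => aIdeal_le_of_isCoatom, ?_, ?_⟩
  · refine TwoSidedIdeal.bijOn_span_image_isCoatom (RingCon.mk'_surjective _) fun M hM => ?_
    rw [TwoSidedIdeal.ker_ringCon_mk']
    exact aIdeal_le_of_isCoatom hM
  · obtain ⟨τ, hτ⟩ := exists_laurent_ringHom_quot (K := K) (n := n)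
    refine ⟨RingEquiv.ofBijective (RingCon.lift _ _ hle) ⟨?_, ?_⟩, fun c => ?_⟩
    · refine Function.LeftInverse.injective (g := τ) fun a => ?_
      obtain ⟨s, rfl⟩ := RingCon.mk'_surjective _ a
      exact hτ s
    · exact RingCon.lift_surjective_of_surjective _ symbol_surjective
    · exact (symbol K n).commutes c
end
end

section
/- The polynomial algebra P_n is, up to isomorphism, the only faithful simple left S_n-module: every faithful simple left S_n-module is isomorphic to P_n. Consequently the algebra S_n is primitive and its Jacobson radical is zero. -/
set_option synthInstance.maxHeartbeats 1000000
set_option maxHeartbeats 1000000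

open MvPolynomial

noncomputable section

/-- The left `S_n`-module structure on `P_n`, via the inclusion `S_n ⊆ End_K(P_n)`. -/
noncomputable instance polyModule (K : Type u) [Field K] (n : ℕ) :
    Module (SnAlg K n) (PolyAlg K n) :=
  Module.compHom _ (SnAlg K n).val.toRingHom

theorem coeff_Yop (K : Type u) [Field K] (n : ℕ) (i : Fin n) (q : PolyAlg K n) (β : Fin n →₀ ℕ) :
    coeff β (Yop K n i q) = coeff (β + Finsupp.single i 1) q := by
  have key : lcoeff K β ∘ₗ Yop K n i = lcoeff K (β + Finsupp.single i 1) := by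
    refine (basisMonomials (Fin n) K).ext fun α => ?_
    have hb : Yop K n i (basisMonomials (Fin n) K α) =
        if α i = 0 then 0 else monomial (α - Finsupp.single i 1) (1 : K) :=
      Module.Basis.constr_basis _ _ _ _
    rw [LinearMap.comp_apply, hb, coe_basisMonomials]
    rcases eq_or_ne (α i) 0 with h | h
    · have hne : α ≠ β + Finsupp.single i 1 := by
        rintro rfl
        simp at h
      simp [h, coeff_monomial, hne]
    · have hle : Finsupp.single i 1 ≤ α :=
        Finsupp.single_le_iff.2 (Nat.one_le_iff_ne_zero.2 h)
      simp only [if_neg h, lcoeff_apply, coeff_monomial]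
      congr 1
      exact propext (tsub_eq_iff_eq_add_of_le hle)
  exact LinearMap.congr_fun key q

theorem coeff_Xop_Yop (K : Type u) [Field K] (n : ℕ) (i : Fin n) (q : PolyAlg K n)
    (β : Fin n →₀ ℕ) :
    coeff β (Xop K n i (Yop K n i q)) = if β i = 0 then 0 else coeff β q := by
  change coeff β (X i * Yop K n i q) = _
  rw [coeff_X_mul']
  rcases eq_or_ne (β i) 0 with h | h
  · simp [h]
  · have hle : Finsupp.single i 1 ≤ β :=
      Finsupp.single_le_iff.2 (Nat.one_le_iff_ne_zero.2 h)
    rw [if_pos (Finsupp.mem_support_iff.2 h), if_neg h, coeff_Yop, tsub_add_cancel_of_le hle]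

/-- The shift `y^α` lies in `S_n`. -/
theorem exists_mem_SnAlg_coeff_shift (K : Type u) [Field K] (n : ℕ) (α : Fin n →₀ ℕ) :
    ∃ s ∈ SnAlg K n, ∀ (q : PolyAlg K n) (β : Fin n →₀ ℕ), coeff β (s q) = coeff (β + α) q := by
  induction α using Finsupp.induction_linear with
  | zero => exact ⟨1, one_mem _, by simp⟩
  | add a b ha hb =>
    obtain ⟨s, hs, hsc⟩ := ha
    obtain ⟨t, ht, htc⟩ := hb
    refine ⟨s * t, mul_mem hs ht, fun q β => ?_⟩
    rw [Module.End.mul_apply, hsc, htc, add_assoc]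
  | single i k =>
    induction k with
    | zero => exact ⟨1, one_mem _, by simp⟩
    | succ k ih =>
      obtain ⟨s, hs, hsc⟩ := ih
      refine ⟨s * Yop K n i, mul_mem hs (yS K n i).2, fun q β => ?_⟩
      rw [Module.End.mul_apply, hsc, coeff_Yop, add_assoc, ← Finsupp.single_add]

/-- The projection `∏ (1 - x_i y_i)` of `P_n` onto the constants lies in `S_n`. -/
theorem exists_mem_SnAlg_eq_C_coeff_zero (K : Type u) [Field K] (n : ℕ) :
    ∃ s ∈ SnAlg K n, ∀ q : PolyAlg K n, s q = C (coeff 0 q) := by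
  have finset_prod (T : Finset (Fin n)) : ∃ s ∈ SnAlg K n,
      ∀ (q : PolyAlg K n) (β : Fin n →₀ ℕ), coeff β (s q) =
        if ∀ i ∈ T, β i = 0 then coeff β q else 0 := by
    induction T using Finset.induction_on with
    | empty => exact ⟨1, one_mem _, by simp⟩
    | insert i T _ ih =>
      obtain ⟨s, hs, hsc⟩ := ih
      refine ⟨(1 - Xop K n i * Yop K n i) * s,
        mul_mem (sub_mem (one_mem _) (mul_mem (xS K n i).2 (yS K n i).2)) hs, fun q β => ?_⟩
      rw [Module.End.mul_apply, LinearMap.sub_apply, Module.End.one_apply, Module.End.mul_apply,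
        coeff_sub, coeff_Xop_Yop, hsc]
      by_cases h : β i = 0 <;> simp [h]
  obtain ⟨s, hs, hsc⟩ := finset_prod Finset.univ
  refine ⟨s, hs, fun q => MvPolynomial.ext _ _ fun β => ?_⟩
  rw [hsc, coeff_C]
  rcases eq_or_ne β 0 with rfl | h
  · simp
  · rw [if_neg (fun h0 => h (Finsupp.ext fun i => h0 i (Finset.mem_univ i))), if_neg h.symm]

theorem mulLeft_mem_SnAlg (K : Type u) [Field K] (n : ℕ) (p : PolyAlg K n) :
    LinearMap.mulLeft K p ∈ SnAlg K n := by
  induction p using MvPolynomial.induction_on with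
  | C a =>
    convert (SnAlg K n).algebraMap_mem a using 1
    exact LinearMap.ext fun q => (MvPolynomial.smul_eq_C_mul q a).symm
  | add p q hp hq =>
    convert add_mem hp hq using 1
    exact LinearMap.ext fun r => add_mul p q r
  | mul_X p i hp =>
    convert mul_mem hp (xS K n i).2 using 1
    exact LinearMap.mulLeft_mul K (PolyAlg K n) p (X i)

theorem toSpanSingleton_poly_surjective (K : Type u) [Field K] (n : ℕ) {q : PolyAlg K n}
    (hq : q ≠ 0) :
    Function.Surjective (LinearMap.toSpanSingleton (SnAlg K n) (PolyAlg K n) q) := by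
  intro p
  obtain ⟨α, hα⟩ := MvPolynomial.ne_zero_iff.1 hq
  obtain ⟨s, hs, hsc⟩ := exists_mem_SnAlg_coeff_shift K n α
  obtain ⟨e, he, hec⟩ := exists_mem_SnAlg_eq_C_coeff_zero K n
  refine ⟨⟨LinearMap.mulLeft K (p * C (coeff α q)⁻¹) * e * s,
    mul_mem (mul_mem (mulLeft_mem_SnAlg K n _) he) hs⟩, ?_⟩
  change p * C (coeff α q)⁻¹ * e (s q) = p
  rw [hec, hsc, zero_add, mul_assoc, ← C_mul, inv_mul_cancel₀ hα, C_1, mul_one]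

theorem isSimpleModule_poly (K : Type u) [Field K] (n : ℕ) :
    IsSimpleModule (SnAlg K n) (PolyAlg K n) :=
  isSimpleModule_iff_toSpanSingleton_surjective.2
    ⟨inferInstance, fun _ hq => toSpanSingleton_poly_surjective K n hq⟩

theorem faithful_poly (K : Type u) [Field K] (n : ℕ) (r : SnAlg K n)
    (hr : ∀ q : PolyAlg K n, r • q = 0) : r = 0 :=
  Subtype.ext (LinearMap.ext hr)

/-- Two simple modules with nonzero elements `x`, `y` satisfying `ann x ⊆ ann y`
are isomorphic. -/
theorem nonempty_equiv_of_annihilator_le {R N M : Type*} [Ring R] [AddCommGroup N] [Module R N]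
    [AddCommGroup M] [Module R M] [IsSimpleModule R N] [IsSimpleModule R M] {x : N} {y : M}
    (hx : x ≠ 0) (hy : y ≠ 0) (h : ∀ r : R, r • x = 0 → r • y = 0) :
    Nonempty (N ≃ₗ[R] M) := by
  let f := LinearMap.toSpanSingleton R N x
  let g := LinearMap.toSpanSingleton R M y
  have hf : Function.Surjective f := IsSimpleModule.toSpanSingleton_surjective R hx
  have hle : LinearMap.ker f ≤ LinearMap.ker g := h
  let ψ := f.quotKerEquivOfSurjective hf
  let φ : N →ₗ[R] M := (LinearMap.ker f).liftQ g hle ∘ₗ ψ.symm.toLinearMap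
  have hφx : φ x = y := by
    have hψ : ψ.symm x = Submodule.Quotient.mk 1 :=
      (LinearEquiv.symm_apply_eq _).2 (one_smul R x).symm
    rw [LinearMap.comp_apply, LinearEquiv.coe_coe, hψ]
    exact one_smul R y
  have hφ : φ ≠ 0 := by
    intro h0
    exact hy (by rw [← hφx, h0, LinearMap.zero_apply])
  exact ⟨LinearEquiv.ofBijective φ (LinearMap.bijective_of_ne_zero hφ)⟩

theorem nonempty_equiv_poly (K : Type u) [Field K] (n : ℕ) (M : Type*) [AddCommGroup M]
    [Module (SnAlg K n) M] (hM : IsSimpleModule (SnAlg K n) M)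
    (hf : ∀ r : SnAlg K n, (∀ m : M, r • m = 0) → r = 0) :
    Nonempty (M ≃ₗ[SnAlg K n] PolyAlg K n) := by
  obtain ⟨e, he, hec⟩ := exists_mem_SnAlg_eq_C_coeff_zero K n
  let E : SnAlg K n := ⟨e, he⟩
  have hE : E ≠ 0 := fun h => by
    have h1 : e 1 = 0 := LinearMap.congr_fun (congrArg Subtype.val h) 1
    simp [hec] at h1
  obtain ⟨m, hm⟩ : ∃ m : M, E • m ≠ 0 := by
    by_contra! h
    exact hE (hf E h)
  have := isSimpleModule_poly K n
  refine (nonempty_equiv_of_annihilator_le (R := SnAlg K n) (x := (1 : PolyAlg K n)) one_ne_zero hm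
    fun s hs => ?_).map LinearEquiv.symm
  have hs1 : s.1 1 = 0 := hs
  have hsE : s * E = 0 := by
    refine faithful_poly K n _ fun q => ?_
    change s.1 (e q) = 0
    rw [hec, ← mul_one (C _), ← smul_eq_C_mul, map_smul, hs1, smul_zero]
  rw [← mul_smul, hsE, zero_smul]

/-- `P_n` is, up to isomorphism, the only faithful simple left `S_n`-module;
consequently `S_n` is primitive and its Jacobson radical (the intersection of the
annihilators of all simple left `S_n`-modules) is zero. -/
theorem statement16 (K : Type u) [Field K] (n : ℕ) (hn : 0 < n) :
    (∀ (M : Type u) [AddCommGroup M] [Module (SnAlg K n) M],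
      IsSimpleModule (SnAlg K n) M → (∀ r : SnAlg K n, (∀ m : M, r • m = 0) → r = 0) →
      Nonempty (M ≃ₗ[SnAlg K n] PolyAlg K n)) ∧
    (∃ M : ModuleCat.{u} (SnAlg K n),
      IsSimpleModule (SnAlg K n) M ∧ ∀ r : SnAlg K n, (∀ m : M, r • m = 0) → r = 0) ∧
    (∀ r : SnAlg K n,
      (∀ (M : ModuleCat.{u} (SnAlg K n)), IsSimpleModule (SnAlg K n) M → ∀ m : M, r • m = 0) →
      r = 0) := by
  refine ⟨fun M _ _ hM hf => nonempty_equiv_poly K n M hM hf,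
    ⟨ModuleCat.of (SnAlg K n) (PolyAlg K n), isSimpleModule_poly K n, faithful_poly K n⟩,
    fun r hr => faithful_poly K n r ?_⟩
  exact hr (ModuleCat.of (SnAlg K n) (PolyAlg K n)) (isSimpleModule_poly K n)
end
end
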